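/- arXiv:2103.12403 — 7 statements merged into one kernel-verified Lean document; each statement's English description precedes it below -/
import Mathlib

section
/- Let φ : ℋ → ℂ be a ℂ-linear map whose kernel is exactly the range of π_E. Then there exists ν ∈ ℂ such that φ(π_H(f)) = -ν·φ(f) for all f ∈ ℋ. -/
noncomputable section

/-- Let `ℋ` be a complex vector space with `ℂ`-linear maps
`π_H, π_E : ℋ → ℋ` such that `π_H∘π_E − π_E∘π_H = (1/√2)·π_E` and `π_E` injective.
If `φ : ℋ → ℂ` is a `ℂ`-linear map whose kernel is exactly the range of `π_E`, then there
exists `ν ∈ ℂ` such that `φ(π_H(f)) = -ν·φ(f)` for all `f ∈ ℋ`. -/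
theorem stmt9 (H : Type*) [AddCommGroup H] [Module ℂ H]
    (πH πE : H →ₗ[ℂ] H)
    (hcomm : πH ∘ₗ πE - πE ∘ₗ πH = ((Real.sqrt 2 : ℂ))⁻¹ • πE)
    (hinj : Function.Injective πE)
    (φ : H →ₗ[ℂ] ℂ) (hker : LinearMap.ker φ = LinearMap.range πE) :
    ∃ ν : ℂ, ∀ f : H, φ (πH f) = -ν * φ f := by
  have key (x : H) (hx : φ x = 0) : φ (πH x) = 0 := by
    obtain ⟨g, rfl⟩ : x ∈ LinearMap.range πE := hker ▸ LinearMap.mem_ker.2 hx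
    have hE : φ (πE (πH g)) = 0 :=
      LinearMap.mem_ker.1 (hker ▸ LinearMap.mem_range_self πE (πH g))
    simpa [hx, hE] using congrArg φ (LinearMap.congr_fun hcomm g)
  by_cases h : ∃ v, φ v ≠ 0
  · obtain ⟨v, hv⟩ := h
    refine ⟨-(φ (πH v) / φ v), fun f => ?_⟩
    have hf := key (f - (φ f / φ v) • v) (by simp [hv])
    simp only [map_sub, map_smul, smul_eq_mul, sub_eq_zero] at hf
    rw [hf]
    ring
  · push Not at h
    exact ⟨0, fun f => by simp [h]⟩
end
end

section
/- Suppose ν ∈ ℂ and S : ℋ → ℋ is a ℂ-linear map with π_E∘S = π_H + ν·id_ℋ. Let V be a complex vector space, ξ_H : V → V a ℂ-linear map, W = ℋ ⊗_ℂ V, 𝐇 = π_H⊗id_V + id_ℋ⊗ξ_H, 𝐄 = π_E⊗id_V. Define d⁰ : W → W×W by d⁰(w) = (𝐇w, 𝐄w), d¹ : W×W → W by d¹(u,v) = 𝐇v − 𝐄u − (1/√2)v, δ¹ : W×W → W by δ¹(u,v) = u − (S⊗id_V)v, and δ² : W → W×W by δ²(w) = ((S⊗id_V)w, w). Then: (i)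 δ¹∘d⁰ = id_ℋ⊗ξ_H − (ν + 1/√2)·id_W on W; (ii) d⁰∘δ¹ + δ²∘d¹ = (applied componentwise) id_ℋ⊗ξ_H − (ν + 1/√2)·id on W×W; (iii) d¹∘δ² = id_ℋ⊗ξ_H − (ν + 1/√2)·id_W on W; and (iv) δ¹∘δ² = 0. -/
open scoped TensorProduct

noncomputable section

section

variable {R M : Type*} [CommRing R] [AddCommGroup M] [Module R M]
  {h e s : M →ₗ[R] M} {c ν : R}

/-- If `[h, e] = c e` with `e` injective and `e ∘ s = h + ν`, then `s ∘ e = h + (ν + c)`. -/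
theorem comp_eq_of_commutator (hcomm : h ∘ₗ e - e ∘ₗ h = c • e)
    (hinj : Function.Injective e) (hs : e ∘ₗ s = h + ν • LinearMap.id) :
    s ∘ₗ e = h + (ν + c) • LinearMap.id := by
  ext x
  apply hinj
  have h1 := LinearMap.congr_fun hcomm x
  have h2 := LinearMap.congr_fun hs (e x)
  simp only [LinearMap.sub_apply, LinearMap.add_apply, LinearMap.smul_apply,
    LinearMap.comp_apply, LinearMap.id_apply, map_add, map_smul] at h1 h2 ⊢
  rw [h2, sub_eq_iff_eq_add.mp h1]
  module

/-- If `[h, e] = c e` with `e` injective and `e ∘ s = h + ν`, then `[s, h] = c s`. -/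
theorem comp_comm_of_commutator (hcomm : h ∘ₗ e - e ∘ₗ h = c • e)
    (hinj : Function.Injective e) (hs : e ∘ₗ s = h + ν • LinearMap.id) :
    s ∘ₗ h = h ∘ₗ s + c • s := by
  ext x
  apply hinj
  have h1 := LinearMap.congr_fun hcomm (s x)
  have h2 := LinearMap.congr_fun hs (h x)
  have h3 := LinearMap.congr_fun hs x
  simp only [LinearMap.sub_apply, LinearMap.add_apply, LinearMap.smul_apply,
    LinearMap.comp_apply, LinearMap.id_apply, map_add, map_smul] at h1 h2 h3 ⊢
  rw [h2, ← h1, h3]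
  simp only [map_add, map_smul]
  abel

end

/-- Let `ℋ` be a complex vector space with `ℂ`-linear maps `π_H, π_E`
satisfying `π_H∘π_E − π_E∘π_H = (1/√2)·π_E`, `π_E` injective, and let `S` satisfy
`π_E∘S = π_H + ν·id`.  For a complex vector space `V` with `ξ_H : V → V` linear, set
`W = ℋ⊗V`, `𝐇 = π_H⊗id + id⊗ξ_H`, `𝐄 = π_E⊗id`, and define
`d⁰(w) = (𝐇w, 𝐄w)`, `d¹(u,v) = 𝐇v − 𝐄u − (1/√2)v`, `δ¹(u,v) = u − (S⊗id)v`,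
`δ²(w) = ((S⊗id)w, w)`.  Then, with `K = id⊗ξ_H − (ν + 1/√2)·id`:
(i) `δ¹∘d⁰ = K`; (ii) `d⁰∘δ¹ + δ²∘d¹ = K` componentwise; (iii) `d¹∘δ² = K`;
(iv) `δ¹∘δ² = 0`. -/
theorem stmt12 (H V : Type*) [AddCommGroup H] [Module ℂ H] [AddCommGroup V] [Module ℂ V]
    (πH πE : H →ₗ[ℂ] H)
    (hcomm : πH ∘ₗ πE - πE ∘ₗ πH = ((Real.sqrt 2 : ℂ))⁻¹ • πE)
    (hinj : Function.Injective πE)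
    (ν : ℂ) (S : H →ₗ[ℂ] H)
    (hS : πE ∘ₗ S = πH + ν • LinearMap.id)
    (ξH : V →ₗ[ℂ] V) :
    let W := H ⊗[ℂ] V
    let bigH : W →ₗ[ℂ] W :=
      TensorProduct.map πH LinearMap.id + TensorProduct.map LinearMap.id ξH
    let bigE : W →ₗ[ℂ] W := TensorProduct.map πE LinearMap.id
    let d0 : W →ₗ[ℂ] W × W := bigH.prod bigE
    let d1 : W × W →ₗ[ℂ] W :=
      bigH ∘ₗ LinearMap.snd ℂ W W - bigE ∘ₗ LinearMap.fst ℂ W W -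
        ((Real.sqrt 2 : ℂ))⁻¹ • LinearMap.snd ℂ W W
    let δ1 : W × W →ₗ[ℂ] W :=
      LinearMap.fst ℂ W W - TensorProduct.map S LinearMap.id ∘ₗ LinearMap.snd ℂ W W
    let δ2 : W →ₗ[ℂ] W × W := (TensorProduct.map S LinearMap.id).prod LinearMap.id
    let K : W →ₗ[ℂ] W :=
      TensorProduct.map LinearMap.id ξH - (ν + ((Real.sqrt 2 : ℂ))⁻¹) • LinearMap.id
    δ1 ∘ₗ d0 = K ∧
    d0 ∘ₗ δ1 + δ2 ∘ₗ d1 = K.prodMap K ∧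
    d1 ∘ₗ δ2 = K ∧
    δ1 ∘ₗ δ2 = 0 := by
  intro W bigH bigE d0 d1 δ1 δ2 K
  have hSE (w : W) : TensorProduct.map S LinearMap.id (TensorProduct.map πE LinearMap.id w) =
      TensorProduct.map πH LinearMap.id w + (ν + ((Real.sqrt 2 : ℂ))⁻¹) • w := by
    have := congrArg (fun f => TensorProduct.map f (LinearMap.id : V →ₗ[ℂ] V) w)
      (comp_eq_of_commutator hcomm hinj hS)
    simpa [TensorProduct.map_add_left, TensorProduct.map_smul_left,
      ← LinearMap.comp_apply, ← TensorProduct.map_comp] using this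
  have hES (w : W) : TensorProduct.map πE LinearMap.id (TensorProduct.map S LinearMap.id w) =
      TensorProduct.map πH LinearMap.id w + ν • w := by
    have := congrArg (fun f => TensorProduct.map f (LinearMap.id : V →ₗ[ℂ] V) w) hS
    simpa [TensorProduct.map_add_left, TensorProduct.map_smul_left,
      ← LinearMap.comp_apply, ← TensorProduct.map_comp] using this
  have hSH (w : W) : TensorProduct.map S LinearMap.id (TensorProduct.map πH LinearMap.id w) =
      TensorProduct.map πH LinearMap.id (TensorProduct.map S LinearMap.id w) +
        ((Real.sqrt 2 : ℂ))⁻¹ • TensorProduct.map S LinearMap.id w := by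
    have := congrArg (fun f => TensorProduct.map f (LinearMap.id : V →ₗ[ℂ] V) w)
      (comp_comm_of_commutator hcomm hinj hS)
    simpa [TensorProduct.map_add_left, TensorProduct.map_smul_left,
      ← LinearMap.comp_apply, ← TensorProduct.map_comp] using this
  have hSξ (w : W) : TensorProduct.map S LinearMap.id (TensorProduct.map LinearMap.id ξH w) =
      TensorProduct.map LinearMap.id ξH (TensorProduct.map S LinearMap.id w) := by
    simp [← LinearMap.comp_apply, ← TensorProduct.map_comp]
  refine ⟨LinearMap.ext fun w => ?_, LinearMap.ext fun ⟨u, v⟩ => Prod.ext ?_ ?_,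
    LinearMap.ext fun w => ?_, LinearMap.ext fun w => ?_⟩
  all_goals
    simp only [d0, d1, δ1, δ2, K, bigH, bigE, LinearMap.comp_apply, LinearMap.add_apply,
      LinearMap.sub_apply, LinearMap.smul_apply, LinearMap.prod_apply, Function.prod_apply,
      LinearMap.prodMap_apply, LinearMap.fst_apply, LinearMap.snd_apply, LinearMap.id_apply,
      LinearMap.zero_apply, Prod.fst_add, Prod.snd_add, Prod.fst_sub, Prod.snd_sub, Prod.smul_fst,
      Prod.smul_snd, map_add, map_sub, map_smul, hSE, hES, hSH, hSξ]
    module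
end
end

section
/- Suppose ν ∈ ℂ and S : ℋ → ℋ is a ℂ-linear map with π_E∘S = π_H + ν·id_ℋ. Let V be a complex vector space, c ∈ ℂ with c ≠ ν + 1/√2, W = ℋ ⊗_ℂ V, 𝐇 = π_H⊗id_V + c·id_W, 𝐄 = π_E⊗id_V. Define d⁰(w) = (𝐇w, 𝐄w), d¹(u,v) = 𝐇v − 𝐄u − (1/√2)v, δ¹(u,v) = u − (S⊗id_V)v, δ²(w) = ((S⊗id_V)w, w). Then: ker d⁰ = 0; ker d¹ = range d⁰; range d¹ = W; W = range δ¹; W×W = range d⁰ ⊕ range δ² (internal direct sum); ker δ¹ = range δ²; ker δ² = 0. In particular the complex 0 → W → W×W → W → 0 is exact, i.e., all its cohomology vanishes. -/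
open scoped TensorProduct

noncomputable section

/-- The maps `d⁰, d¹, δ¹, δ²` built from `A, E, S` form a split exact complex when `E` is
injective, `A E - E A = k E`, `E S = A + ν` and `c ≠ ν + k`: up to the scalar `c - (ν + k)`, the
`δ`s are a contracting homotopy. -/
theorem exact_of_commutator {K W : Type*} [Field K] [AddCommGroup W] [Module K W]
    (A E S : W →ₗ[K] W) (k ν c : K)
    (hcomm : ∀ w, A (E w) = E (A w) + k • E w) (hinj : Function.Injective E)
    (hES : ∀ w, E (S w) = A w + ν • w) (hc : c ≠ ν + k) :
    let B : W →ₗ[K] W := A + c • LinearMap.id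
    let d0 : W →ₗ[K] W × W := B.prod E
    let d1 : W × W →ₗ[K] W :=
      B ∘ₗ LinearMap.snd K W W - E ∘ₗ LinearMap.fst K W W - k • LinearMap.snd K W W
    let δ1 : W × W →ₗ[K] W := LinearMap.fst K W W - S ∘ₗ LinearMap.snd K W W
    let δ2 : W →ₗ[K] W × W := S.prod LinearMap.id
    LinearMap.ker d0 = ⊥ ∧
    LinearMap.ker d1 = LinearMap.range d0 ∧
    LinearMap.range d1 = ⊤ ∧
    LinearMap.range δ1 = ⊤ ∧
    IsCompl (LinearMap.range d0) (LinearMap.range δ2) ∧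
    LinearMap.ker δ1 = LinearMap.range δ2 ∧
    LinearMap.ker δ2 = ⊥ := by
  intro B d0 d1 δ1 δ2
  have hd0 (w) : d0 w = (A w + c • w, E w) := rfl
  have hd1 (p) : d1 p = A p.2 + c • p.2 - E p.1 - k • p.2 := rfl
  have hδ1 (p) : δ1 p = p.1 - S p.2 := rfl
  have hδ2 (w) : δ2 w = (S w, w) := rfl
  have hl : c - (ν + k) ≠ 0 := sub_ne_zero.mpr hc
  have hSE (w) : S (E w) = A w + (ν + k) • w := by
    apply hinj
    rw [hES, hcomm, map_add, map_smul]
    module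
  have hSA (w) : S (A w) = A (S w) + k • S w := by
    apply hinj
    have h := hcomm (S w)
    rw [hES, map_add, map_smul] at h
    rw [hES, map_add, map_smul, hES, h]
  have hdd (w) : d1 (d0 w) = 0 := by
    simp only [hd0, hd1, hcomm, map_add, map_smul]
    module
  have hδδ (w) : δ1 (δ2 w) = 0 := by simp [hδ1, hδ2]
  have hδd (w) : δ1 (d0 w) = (c - (ν + k)) • w := by
    simp only [hd0, hδ1, hSE]
    module
  have hdδ (w) : d1 (δ2 w) = (c - (ν + k)) • w := by
    simp only [hδ2, hd1, hES]
    module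
  have hhom (p) : d0 (δ1 p) + δ2 (d1 p) = (c - (ν + k)) • p := by
    ext
    · simp only [hd0, hδ2, hd1, hδ1, map_add, map_sub, map_smul, hSE, hSA, Prod.fst_add,
        Prod.smul_fst]
      module
    · simp only [hd0, hδ2, hd1, hδ1, map_sub, hES, Prod.snd_add, Prod.smul_snd]
      module
  have hker0 : LinearMap.ker d0 = ⊥ := by
    refine (LinearMap.ker_eq_bot').mpr fun w hw => ?_
    have h := hδd w
    rw [hw, map_zero] at h
    exact (smul_eq_zero.mp h.symm).resolve_left hl
  have hker1 : LinearMap.ker d1 = LinearMap.range d0 := by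
    apply le_antisymm
    · intro p hp
      have h := hhom p
      rw [LinearMap.mem_ker.mp hp, map_zero, add_zero] at h
      exact ⟨(c - (ν + k))⁻¹ • δ1 p, by rw [map_smul, h, inv_smul_smul₀ hl]⟩
    · rintro _ ⟨w, rfl⟩
      exact hdd w
  have hkerδ1 : LinearMap.ker δ1 = LinearMap.range δ2 := by
    apply le_antisymm
    · intro p hp
      exact ⟨p.2, Prod.ext (sub_eq_zero.mp (LinearMap.mem_ker.mp hp)).symm rfl⟩
    · rintro _ ⟨w, rfl⟩
      exact hδδ w
  refine ⟨hker0, hker1, ?_, ?_, ⟨?_, ?_⟩, hkerδ1, ?_⟩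
  · refine LinearMap.range_eq_top.mpr fun w => ⟨δ2 ((c - (ν + k))⁻¹ • w), ?_⟩
    rw [hdδ, smul_inv_smul₀ hl]
  · exact LinearMap.range_eq_top.mpr fun w => ⟨(w, 0), by simp [hδ1]⟩
  · rw [Submodule.disjoint_def, ← hker1, ← hkerδ1]
    intro p hp hp'
    have h := hhom p
    rw [LinearMap.mem_ker.mp hp, LinearMap.mem_ker.mp hp', map_zero, map_zero, add_zero] at h
    exact (smul_eq_zero.mp h.symm).resolve_left hl
  · rw [codisjoint_iff, eq_top_iff]
    intro p _
    refine Submodule.mem_sup.mpr ⟨_, ⟨(c - (ν + k))⁻¹ • δ1 p, rfl⟩, _,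
      ⟨(c - (ν + k))⁻¹ • d1 p, rfl⟩, ?_⟩
    rw [map_smul, map_smul, ← smul_add, hhom, inv_smul_smul₀ hl]
  · exact LinearMap.ker_eq_bot'.mpr fun w hw => congrArg Prod.snd hw

/-- Let `ℋ` be a complex vector space with `ℂ`-linear maps `π_H, π_E`
satisfying `π_H∘π_E − π_E∘π_H = (1/√2)·π_E`, `π_E` injective, and `S` with
`π_E∘S = π_H + ν·id`.  For a complex vector space `V` and `c ∈ ℂ` with `c ≠ ν + 1/√2`, set
`W = ℋ⊗V`, `𝐇 = π_H⊗id + c·id`, `𝐄 = π_E⊗id`, `d⁰(w) = (𝐇w, 𝐄w)`,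
`d¹(u,v) = 𝐇v − 𝐄u − (1/√2)v`, `δ¹(u,v) = u − (S⊗id)v`, `δ²(w) = ((S⊗id)w, w)`.  Then
`ker d⁰ = 0`, `ker d¹ = range d⁰`, `range d¹ = W`, `W = range δ¹`,
`W×W = range d⁰ ⊕ range δ²` (internal direct sum), `ker δ¹ = range δ²`, `ker δ² = 0`;
in particular the complex `0 → W → W×W → W → 0` is exact. -/
theorem stmt13 (H V : Type*) [AddCommGroup H] [Module ℂ H] [AddCommGroup V] [Module ℂ V]
    (πH πE : H →ₗ[ℂ] H)
    (hcomm : πH ∘ₗ πE - πE ∘ₗ πH = ((Real.sqrt 2 : ℂ))⁻¹ • πE)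
    (hinj : Function.Injective πE)
    (ν : ℂ) (S : H →ₗ[ℂ] H)
    (hS : πE ∘ₗ S = πH + ν • LinearMap.id)
    (c : ℂ) (hc : c ≠ ν + ((Real.sqrt 2 : ℂ))⁻¹) :
    let W := H ⊗[ℂ] V
    let bigH : W →ₗ[ℂ] W := TensorProduct.map πH LinearMap.id + c • LinearMap.id
    let bigE : W →ₗ[ℂ] W := TensorProduct.map πE LinearMap.id
    let d0 : W →ₗ[ℂ] W × W := bigH.prod bigE
    let d1 : W × W →ₗ[ℂ] W :=
      bigH ∘ₗ LinearMap.snd ℂ W W - bigE ∘ₗ LinearMap.fst ℂ W W -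
        ((Real.sqrt 2 : ℂ))⁻¹ • LinearMap.snd ℂ W W
    let δ1 : W × W →ₗ[ℂ] W :=
      LinearMap.fst ℂ W W - TensorProduct.map S LinearMap.id ∘ₗ LinearMap.snd ℂ W W
    let δ2 : W →ₗ[ℂ] W × W := (TensorProduct.map S LinearMap.id).prod LinearMap.id
    LinearMap.ker d0 = ⊥ ∧
    LinearMap.ker d1 = LinearMap.range d0 ∧
    LinearMap.range d1 = ⊤ ∧
    LinearMap.range δ1 = ⊤ ∧
    IsCompl (LinearMap.range d0) (LinearMap.range δ2) ∧
    LinearMap.ker δ1 = LinearMap.range δ2 ∧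
    LinearMap.ker δ2 = ⊥ := by
  have hcomm' : πH ∘ₗ πE = πE ∘ₗ πH + ((Real.sqrt 2 : ℂ))⁻¹ • πE := by
    rw [← hcomm, add_sub_cancel]
  refine exact_of_commutator (πH.rTensor V) (πE.rTensor V) (S.rTensor V) _ ν c (fun w => ?_)
    (Module.Flat.rTensor_preserves_injective_linearMap πE hinj) (fun w => ?_) hc
  · rw [← LinearMap.rTensor_comp_apply, hcomm', LinearMap.rTensor_add, LinearMap.rTensor_smul,
      LinearMap.rTensor_comp]
    rfl
  · rw [← LinearMap.rTensor_comp_apply, hS, LinearMap.rTensor_add, LinearMap.rTensor_smul,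
      LinearMap.rTensor_id]
    rfl
end
end

section
/- Let φ : ℋ → ℂ be a ℂ-linear map whose kernel is exactly the range of π_E, let ν ∈ ℂ satisfy φ∘π_H = -ν·φ, and let h₀ ∈ ℋ satisfy φ(h₀) = 1. Let T : ℋ → ℋ be the unique ℂ-linear map with π_E∘T = id_ℋ − φ(·)h₀ (where φ(·)h₀ denotes f ↦ φ(f)·h₀), and let h₀' ∈ ℋ be the unique element with π_E(h₀') = π_H(h₀) + ν·h₀. Then π_H∘T − T∘π_H = -φ(·)h₀' − (1/√2)·T. -/
noncomputable section

/-- Let `ℋ` be a complex vector space with `ℂ`-linear maps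
`π_H, π_E : ℋ → ℋ` such that `π_H∘π_E − π_E∘π_H = (1/√2)·π_E` and `π_E` injective.
Let `φ : ℋ → ℂ` be `ℂ`-linear with kernel exactly the range of `π_E`, let `ν ∈ ℂ` satisfy
`φ∘π_H = -ν·φ`, and let `h₀ ∈ ℋ` satisfy `φ(h₀) = 1`.  If `T : ℋ → ℋ` is (the unique)
`ℂ`-linear map with `π_E∘T = id − φ(·)h₀` and `h₀' ∈ ℋ` is (the unique) element with
`π_E(h₀') = π_H(h₀) + ν·h₀`, then `π_H∘T − T∘π_H = -φ(·)h₀' − (1/√2)·T`. -/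
theorem stmt14 (H : Type*) [AddCommGroup H] [Module ℂ H]
    (πH πE : H →ₗ[ℂ] H)
    (hcomm : πH ∘ₗ πE - πE ∘ₗ πH = ((Real.sqrt 2 : ℂ))⁻¹ • πE)
    (hinj : Function.Injective πE)
    (φ : H →ₗ[ℂ] ℂ) (hker : LinearMap.ker φ = LinearMap.range πE)
    (ν : ℂ) (hφH : φ ∘ₗ πH = -ν • φ)
    (h₀ : H) (hh₀ : φ h₀ = 1)
    (T : H →ₗ[ℂ] H)
    (hT : πE ∘ₗ T = LinearMap.id - LinearMap.toSpanSingleton ℂ H h₀ ∘ₗ φ)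
    (h₀' : H) (hh₀' : πE h₀' = πH h₀ + ν • h₀) :
    πH ∘ₗ T - T ∘ₗ πH =
      -(LinearMap.toSpanSingleton ℂ H h₀' ∘ₗ φ) - ((Real.sqrt 2 : ℂ))⁻¹ • T := by
  ext f
  apply hinj
  have hcomm_Tf := LinearMap.congr_fun hcomm (T f)
  have hT_f := LinearMap.congr_fun hT f
  have hT_Hf := LinearMap.congr_fun hT (πH f)
  have hφ_Hf := LinearMap.congr_fun hφH f
  simp only [LinearMap.sub_apply, LinearMap.comp_apply, LinearMap.smul_apply, LinearMap.id_apply,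
    LinearMap.toSpanSingleton_apply, smul_eq_mul] at hcomm_Tf hT_f hT_Hf hφ_Hf
  simp only [LinearMap.sub_apply, LinearMap.neg_apply, LinearMap.comp_apply, LinearMap.smul_apply,
    LinearMap.toSpanSingleton_apply, map_sub, map_neg, map_smul, hh₀']
  rw [← hcomm_Tf, hT_Hf, hφ_Hf, hT_f, map_sub, map_smul]
  module
end
end

section
/- Let φ : ℋ → ℂ be a ℂ-linear map whose kernel is exactly the range of π_E, let ν ∈ ℂ satisfy φ∘π_H = -ν·φ, and let h₀ ∈ ℋ satisfy φ(h₀) = 1. Let T be the unique ℂ-linear map with π_E∘T = id_ℋ − φ(·)h₀, and h₀' the unique element with π_E(h₀') = π_H(h₀) + ν·h₀. Let V be a complex vector space, ξ_H : V → V ℂ-linear, W = ℋ⊗_ℂ V, 𝐇 = π_H⊗id_V + id_ℋ⊗ξ_H, 𝐄 = π_E⊗id_V, and define d⁰(w) = (𝐇w, 𝐄w), d¹(u,v) = 𝐇v − 𝐄u − (1/√2)v, δ¹(u,v) = (T⊗id_V)v, δ²(w) = (-(T⊗id_V)w, 0). Let Φ = (φ(·)h₀)⊗id_V and Φ' = (φ(·)h₀')⊗id_V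 on W. Then: (i) δ¹∘d⁰ = id_W; (ii) d⁰∘δ¹ + δ²∘d¹ maps (u,v) to (u − Φ'v, v − Φv); (iii) d¹∘δ² = id_W − Φ. Equivalently, dδ + δd = id − p, where p is given in degrees 0, 1, 2 by p⁰ = 0, p¹(u,v) = (Φ'v, Φv), p² = Φ. -/
open scoped TensorProduct

noncomputable section

/-- A section-up-to-rank-one `T` of an injective `A` is a left inverse of `A` as soon as the
rank-one defect vanishes on the range of `A`. -/
theorem LinearMap.comp_eq_id_of_comp_eq_id_sub {R M : Type*} [CommRing R] [AddCommGroup M]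
    [Module R M] {A T : M →ₗ[R] M} (hA : Function.Injective A) {φ : M →ₗ[R] R}
    (hφA : φ ∘ₗ A = 0) {x₀ : M}
    (hT : A ∘ₗ T = LinearMap.id - LinearMap.toSpanSingleton R M x₀ ∘ₗ φ) :
    T ∘ₗ A = LinearMap.id := by
  ext x
  apply hA
  have hφx : φ (A x) = 0 := LinearMap.congr_fun hφA x
  simpa [hφx] using LinearMap.congr_fun hT (A x)

/-- The commutator of `B` with a section-up-to-rank-one `T` of an injective `A`, where
`[B, A] = c • A`. -/
theorem LinearMap.comp_sub_comp_add_smul_eq_neg {R M : Type*} [CommRing R] [AddCommGroup M]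
    [Module R M] {A B T : M →ₗ[R] M} (hA : Function.Injective A) {c : R}
    (hBA : B ∘ₗ A - A ∘ₗ B = c • A) {φ : M →ₗ[R] R} {ν : R} (hφB : φ ∘ₗ B = -ν • φ) {x₀ y₀ : M}
    (hT : A ∘ₗ T = LinearMap.id - LinearMap.toSpanSingleton R M x₀ ∘ₗ φ)
    (hy₀ : A y₀ = B x₀ + ν • x₀) :
    B ∘ₗ T - T ∘ₗ B + c • T = -(LinearMap.toSpanSingleton R M y₀ ∘ₗ φ) := by
  ext x
  apply hA
  have hAT (z : M) : A (T z) = z - φ z • x₀ := by simpa using LinearMap.congr_fun hT z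
  have hAB : A (B (T x)) = B (A (T x)) - c • A (T x) := by
    have := LinearMap.congr_fun hBA (T x)
    simp only [LinearMap.sub_apply, LinearMap.comp_apply, LinearMap.smul_apply] at this
    rw [← this]
    abel
  have hφBx : φ (B x) = -ν * φ x := by simpa using LinearMap.congr_fun hφB x
  simp only [LinearMap.add_apply, LinearMap.sub_apply, LinearMap.comp_apply, LinearMap.smul_apply,
    LinearMap.neg_apply, LinearMap.toSpanSingleton_apply, map_add, map_sub, map_neg, map_smul,
    hAB, hAT, hφBx, hy₀]
  module

/-- Let `ℋ` be a complex vector space with `ℂ`-linear maps `π_H, π_E`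
satisfying `π_H∘π_E − π_E∘π_H = (1/√2)·π_E` and `π_E` injective.  Let `φ` have kernel exactly
`range π_E`, `φ∘π_H = -ν·φ`, `φ(h₀) = 1`, let `T` be the unique map with
`π_E∘T = id − φ(·)h₀` and `h₀'` the unique element with `π_E(h₀') = π_H(h₀) + ν·h₀`.
For a complex vector space `V` with `ξ_H` linear, set `W = ℋ⊗V`,
`𝐇 = π_H⊗id + id⊗ξ_H`, `𝐄 = π_E⊗id`, `d⁰(w) = (𝐇w, 𝐄w)`, `d¹(u,v) = 𝐇v − 𝐄u − (1/√2)v`,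
`δ¹(u,v) = (T⊗id)v`, `δ²(w) = (−(T⊗id)w, 0)`, `Φ = (φ(·)h₀)⊗id`, `Φ' = (φ(·)h₀')⊗id`.
Then (i) `δ¹∘d⁰ = id`; (ii) `d⁰∘δ¹ + δ²∘d¹` maps `(u,v)` to `(u − Φ'v, v − Φv)`;
(iii) `d¹∘δ² = id − Φ`. -/
theorem stmt15 (H V : Type*) [AddCommGroup H] [Module ℂ H] [AddCommGroup V] [Module ℂ V]
    (πH πE : H →ₗ[ℂ] H)
    (hcomm : πH ∘ₗ πE - πE ∘ₗ πH = ((Real.sqrt 2 : ℂ))⁻¹ • πE)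
    (hinj : Function.Injective πE)
    (φ : H →ₗ[ℂ] ℂ) (hker : LinearMap.ker φ = LinearMap.range πE)
    (ν : ℂ) (hφH : φ ∘ₗ πH = -ν • φ)
    (h₀ : H) (hh₀ : φ h₀ = 1)
    (T : H →ₗ[ℂ] H)
    (hT : πE ∘ₗ T = LinearMap.id - LinearMap.toSpanSingleton ℂ H h₀ ∘ₗ φ)
    (h₀' : H) (hh₀' : πE h₀' = πH h₀ + ν • h₀)
    (ξH : V →ₗ[ℂ] V) :
    let W := H ⊗[ℂ] V
    let bigH : W →ₗ[ℂ] W :=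
      TensorProduct.map πH LinearMap.id + TensorProduct.map LinearMap.id ξH
    let bigE : W →ₗ[ℂ] W := TensorProduct.map πE LinearMap.id
    let d0 : W →ₗ[ℂ] W × W := bigH.prod bigE
    let d1 : W × W →ₗ[ℂ] W :=
      bigH ∘ₗ LinearMap.snd ℂ W W - bigE ∘ₗ LinearMap.fst ℂ W W -
        ((Real.sqrt 2 : ℂ))⁻¹ • LinearMap.snd ℂ W W
    let δ1 : W × W →ₗ[ℂ] W := TensorProduct.map T LinearMap.id ∘ₗ LinearMap.snd ℂ W W
    let δ2 : W →ₗ[ℂ] W × W :=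
      (-(TensorProduct.map T (LinearMap.id : V →ₗ[ℂ] V))).prod (0 : W →ₗ[ℂ] W)
    let Φ : W →ₗ[ℂ] W :=
      TensorProduct.map (LinearMap.toSpanSingleton ℂ H h₀ ∘ₗ φ) LinearMap.id
    let Φ' : W →ₗ[ℂ] W :=
      TensorProduct.map (LinearMap.toSpanSingleton ℂ H h₀' ∘ₗ φ) LinearMap.id
    δ1 ∘ₗ d0 = LinearMap.id ∧
    (∀ x : W × W, (d0 ∘ₗ δ1 + δ2 ∘ₗ d1) x = (x.1 - Φ' x.2, x.2 - Φ x.2)) ∧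
    d1 ∘ₗ δ2 = LinearMap.id - Φ := by
  intro W bigH bigE d0 d1 δ1 δ2 Φ Φ'
  have hφE : φ ∘ₗ πE = 0 := LinearMap.range_le_ker_iff.mp hker.ge
  have hTE := LinearMap.comp_eq_id_of_comp_eq_id_sub hinj hφE hT
  have hHT := LinearMap.comp_sub_comp_add_smul_eq_neg hinj hcomm hφH hT hh₀'
  let bigT : W →ₗ[ℂ] W := TensorProduct.map T LinearMap.id
  have hbigTE : bigT ∘ₗ bigE = LinearMap.id := by
    rw [← TensorProduct.map_comp, hTE, LinearMap.comp_id, TensorProduct.map_id]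
  have hbigET : bigE ∘ₗ bigT = LinearMap.id - Φ := by
    rw [← TensorProduct.map_comp, hT, LinearMap.comp_id]
    exact (LinearMap.rTensor_sub _ _).trans (by rw [LinearMap.rTensor_id]; rfl)
  have hbigHT : bigH ∘ₗ bigT - bigT ∘ₗ bigH + ((Real.sqrt 2 : ℂ))⁻¹ • bigT = -Φ' := by
    refine TensorProduct.ext' fun x v => ?_
    have h := congrArg (· ⊗ₜ[ℂ] v) (LinearMap.congr_fun hHT x)
    simp only [LinearMap.add_apply, LinearMap.sub_apply, LinearMap.comp_apply,
      LinearMap.smul_apply, LinearMap.neg_apply, TensorProduct.add_tmul, TensorProduct.sub_tmul,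
      TensorProduct.neg_tmul, ← TensorProduct.smul_tmul'] at h
    change πH (T x) ⊗ₜ[ℂ] v + T x ⊗ₜ[ℂ] ξH v - bigT (πH x ⊗ₜ[ℂ] v + x ⊗ₜ[ℂ] ξH v) +
      ((Real.sqrt 2 : ℂ))⁻¹ • T x ⊗ₜ[ℂ] v = -(LinearMap.toSpanSingleton ℂ H h₀' (φ x) ⊗ₜ[ℂ] v)
    have hbigT (y : H) (w : V) : bigT (y ⊗ₜ[ℂ] w) = T y ⊗ₜ[ℂ] w := rfl
    rw [map_add, hbigT, hbigT, ← h]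
    abel
  refine ⟨hbigTE, ?_, ?_⟩
  · rintro ⟨u, v⟩
    have hTEu : bigT (bigE u) = u := LinearMap.congr_fun hbigTE u
    have hETv : bigE (bigT v) = v - Φ v := LinearMap.congr_fun hbigET v
    have hHTv : bigH (bigT v) - bigT (bigH v) + ((Real.sqrt 2 : ℂ))⁻¹ • bigT v = -Φ' v :=
      LinearMap.congr_fun hbigHT v
    have hd1 : bigT (d1 (u, v)) = bigT (bigH v) - u - ((Real.sqrt 2 : ℂ))⁻¹ • bigT v := by
      simp [d1, hTEu]
    change (bigH (bigT v) + -bigT (d1 (u, v)), bigE (bigT v) + 0) = (u - Φ' v, v - Φ v)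
    rw [hd1, hETv, add_zero, sub_eq_add_neg u, ← hHTv]
    congr 1
    abel
  · rw [← hbigET]
    refine LinearMap.ext fun w => ?_
    change bigH 0 - bigE (-bigT w) - ((Real.sqrt 2 : ℂ))⁻¹ • (0 : W) = bigE (bigT w)
    simp
end
end

section
/- Let φ : ℋ → ℂ be a ℂ-linear map whose kernel is exactly the range of π_E, let ν ∈ ℂ satisfy φ∘π_H = -ν·φ, and let h₀ ∈ ℋ satisfy φ(h₀) = 1. Let T be the unique ℂ-linear map with π_E∘T = id_ℋ − φ(·)h₀, and h₀' the unique element with π_E(h₀') = π_H(h₀) + ν·h₀. Let V be a complex vector space and set W = ℋ⊗_ℂ V, 𝐇 = π_H⊗id_V + (ν + 1/√2)·id_W, 𝐄 = π_E⊗id_V, d⁰(w) = (𝐇w, 𝐄w), d¹(u,v) = 𝐇v − 𝐄u − (1/√2)v, δ¹(u,v) = (T⊗id_V)v, δ²(w) = (-(T⊗id_V)w, 0), p⁰ = 0, p¹(u,v) = (((φ(·)h₀')⊗id_V)v, ((φ(·)h₀)⊗id_V)v), p² = (φ(·)h₀)⊗id_V. Then in each degree: p∘p = p, d∘p = 0,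 p∘d = 0, δ∘p = 0, p∘δ = 0, dδ + δd = id − p; consequently each term of the complex decomposes as the internal direct sum (range of p) ⊕ (range of d) ⊕ (range of δ), with x = p(x) + d(δx) + δ(dx), range p = ker d ∩ ker δ, ker p = range d ⊕ range δ, ker d = range p ⊕ range d, and ker δ = range p ⊕ range δ. In particular the cohomology of the complex is isomorphic, degree by degree, to the range of p. -/
open scoped TensorProduct

noncomputable section

/-- A homotopy splitting of the term `B` of a complex `A → B → C`: contracting maps `δ₁`, `δ₂`
and a projection `p` with `d₀ δ₁ + δ₂ d₁ = id - p`, all mutually annihilating. -/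
structure HodgeSplitting {R A B C : Type*} [Ring R] [AddCommGroup A] [AddCommGroup B]
    [AddCommGroup C] [Module R A] [Module R B] [Module R C]
    (d₀ : A →ₗ[R] B) (d₁ : B →ₗ[R] C) (δ₁ : B →ₗ[R] A) (δ₂ : C →ₗ[R] B)
    (p : B →ₗ[R] B) : Prop where
  d_d : ∀ a, d₁ (d₀ a) = 0
  δ_δ : ∀ c, δ₁ (δ₂ c) = 0
  p_p : ∀ b, p (p b) = p b
  d_p : ∀ b, d₁ (p b) = 0
  p_d : ∀ a, p (d₀ a) = 0
  δ_p : ∀ b, δ₁ (p b) = 0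
  p_δ : ∀ c, p (δ₂ c) = 0
  homotopy : ∀ b, d₀ (δ₁ b) + δ₂ (d₁ b) = b - p b

namespace HodgeSplitting

variable {R A B C : Type*} [Ring R] [AddCommGroup A] [AddCommGroup B] [AddCommGroup C]
  [Module R A] [Module R B] [Module R C] {d₀ : A →ₗ[R] B} {d₁ : B →ₗ[R] C}
  {δ₁ : B →ₗ[R] A} {δ₂ : C →ₗ[R] B} {p : B →ₗ[R] B}

theorem decomp (h : HodgeSplitting d₀ d₁ δ₁ δ₂ p) (b : B) :
    b = p b + d₀ (δ₁ b) + δ₂ (d₁ b) := by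
  rw [add_assoc, h.homotopy]; abel

theorem range_p (h : HodgeSplitting d₀ d₁ δ₁ δ₂ p) :
    LinearMap.range p = LinearMap.ker d₁ ⊓ LinearMap.ker δ₁ := by
  apply le_antisymm
  · rintro _ ⟨b, rfl⟩
    exact ⟨h.d_p b, h.δ_p b⟩
  · rintro b ⟨hd, hδ⟩
    refine ⟨b, ?_⟩
    have := h.decomp b
    rw [LinearMap.mem_ker.1 hd, LinearMap.mem_ker.1 hδ] at this
    simpa using this.symm

theorem ker_p (h : HodgeSplitting d₀ d₁ δ₁ δ₂ p) :
    LinearMap.ker p = LinearMap.range d₀ ⊔ LinearMap.range δ₂ := by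
  apply le_antisymm
  · intro b hb
    rw [h.decomp b, LinearMap.mem_ker.1 hb, zero_add]
    exact Submodule.add_mem_sup ⟨_, rfl⟩ ⟨_, rfl⟩
  · refine sup_le ?_ ?_
    · rintro _ ⟨a, rfl⟩; exact h.p_d a
    · rintro _ ⟨c, rfl⟩; exact h.p_δ c

theorem ker_d (h : HodgeSplitting d₀ d₁ δ₁ δ₂ p) :
    LinearMap.ker d₁ = LinearMap.range p ⊔ LinearMap.range d₀ := by
  apply le_antisymm
  · intro b hb
    rw [h.decomp b, LinearMap.mem_ker.1 hb, map_zero, add_zero]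
    exact Submodule.add_mem_sup ⟨_, rfl⟩ ⟨_, rfl⟩
  · refine sup_le ?_ ?_
    · rintro _ ⟨b, rfl⟩; exact h.d_p b
    · rintro _ ⟨a, rfl⟩; exact h.d_d a

theorem ker_δ (h : HodgeSplitting d₀ d₁ δ₁ δ₂ p) :
    LinearMap.ker δ₁ = LinearMap.range p ⊔ LinearMap.range δ₂ := by
  apply le_antisymm
  · intro b hb
    rw [h.decomp b, LinearMap.mem_ker.1 hb, map_zero, add_zero]
    exact Submodule.add_mem_sup ⟨_, rfl⟩ ⟨_, rfl⟩
  · refine sup_le ?_ ?_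
    · rintro _ ⟨b, rfl⟩; exact h.δ_p b
    · rintro _ ⟨c, rfl⟩; exact h.δ_δ c

theorem disjoint_d_δ (h : HodgeSplitting d₀ d₁ δ₁ δ₂ p) :
    Disjoint (LinearMap.range d₀) (LinearMap.range δ₂) := by
  rw [Submodule.disjoint_def]
  rintro _ ⟨a, rfl⟩ ⟨c, hc⟩
  have := h.decomp (d₀ a)
  rw [h.p_d, h.d_d, ← hc, h.δ_δ] at this
  simpa [hc] using this

theorem disjoint_p (h : HodgeSplitting d₀ d₁ δ₁ δ₂ p) :
    Disjoint (LinearMap.range p) (LinearMap.range d₀ ⊔ LinearMap.range δ₂) := by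
  rw [← h.ker_p, Submodule.disjoint_def]
  rintro _ ⟨b, rfl⟩ hb
  rw [← h.p_p]
  exact hb

theorem sup_eq_top (h : HodgeSplitting d₀ d₁ δ₁ δ₂ p) :
    LinearMap.range p ⊔ LinearMap.range d₀ ⊔ LinearMap.range δ₂ = ⊤ := by
  refine eq_top_iff.2 fun b _ => ?_
  rw [h.decomp b]
  exact Submodule.add_mem_sup (Submodule.add_mem_sup ⟨_, rfl⟩ ⟨_, rfl⟩) ⟨_, rfl⟩

theorem nonempty_cohomology_equiv (h : HodgeSplitting d₀ d₁ δ₁ δ₂ p) :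
    Nonempty ((↥(LinearMap.ker d₁) ⧸
      (LinearMap.range d₀).comap (LinearMap.ker d₁).subtype) ≃ₗ[R] ↥(LinearMap.range p)) := by
  let f : LinearMap.ker d₁ →ₗ[R] LinearMap.range p := p.rangeRestrict ∘ₗ (LinearMap.ker d₁).subtype
  have hf : (LinearMap.range d₀).comap (LinearMap.ker d₁).subtype = LinearMap.ker f := by
    ext ⟨b, hb⟩
    simp only [Submodule.mem_comap, Submodule.subtype_apply, LinearMap.mem_ker, f,
      LinearMap.comp_apply, Subtype.ext_iff, LinearMap.codRestrict_apply, LinearMap.rangeRestrict,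
      ZeroMemClass.coe_zero]
    constructor
    · rintro ⟨a, rfl⟩; exact h.p_d a
    · intro hp
      refine ⟨δ₁ b, ?_⟩
      have := h.decomp b
      rw [hp, LinearMap.mem_ker.1 hb, map_zero, add_zero, zero_add] at this
      exact this.symm
  have hs : Function.Surjective f := by
    rintro ⟨_, b, rfl⟩
    exact ⟨⟨p b, h.d_p b⟩, Subtype.ext (h.p_p b)⟩
  exact ⟨(Submodule.quotEquivOfEq _ _ hf).trans (f.quotKerEquivOfSurjective hs)⟩

end HodgeSplitting

/-- (Hodge decomposition for the complex with coefficients twisted by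
`ξ_H = (ν + 1/√2)·id`.)  With `ℋ, π_H, π_E, φ, ν, h₀, T, h₀'` as in the context, `V` a
complex vector space, `W = ℋ⊗V`, `𝐇 = π_H⊗id + (ν+1/√2)·id`, `𝐄 = π_E⊗id`,
`d⁰(w) = (𝐇w, 𝐄w)`, `d¹(u,v) = 𝐇v − 𝐄u − (1/√2)v`, `δ¹(u,v) = (T⊗id)v`,
`δ²(w) = (−(T⊗id)w, 0)`, `p⁰ = 0`, `p¹(u,v) = (Φ'v, Φv)`, `p² = Φ`, where
`Φ = (φ(·)h₀)⊗id`, `Φ' = (φ(·)h₀')⊗id`: in each degree `p∘p = p`, `d∘p = 0`, `p∘d = 0`,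
`δ∘p = 0`, `p∘δ = 0`, `dδ + δd = id − p`; each term of the complex decomposes as
`range p ⊕ range d ⊕ range δ` with `x = p x + d(δx) + δ(dx)`,
`range p = ker d ∩ ker δ`, `ker p = range d ⊕ range δ`, `ker d = range p ⊕ range d`,
`ker δ = range p ⊕ range δ`; and the cohomology is isomorphic degree by degree to the
range of `p`. -/
theorem stmt16 (H V : Type*) [AddCommGroup H] [Module ℂ H] [AddCommGroup V] [Module ℂ V]
    (πH πE : H →ₗ[ℂ] H)
    (hcomm : πH ∘ₗ πE - πE ∘ₗ πH = ((Real.sqrt 2 : ℂ))⁻¹ • πE)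
    (hinj : Function.Injective πE)
    (φ : H →ₗ[ℂ] ℂ) (hker : LinearMap.ker φ = LinearMap.range πE)
    (ν : ℂ) (hφH : φ ∘ₗ πH = -ν • φ)
    (h₀ : H) (hh₀ : φ h₀ = 1)
    (T : H →ₗ[ℂ] H)
    (hT : πE ∘ₗ T = LinearMap.id - LinearMap.toSpanSingleton ℂ H h₀ ∘ₗ φ)
    (h₀' : H) (hh₀' : πE h₀' = πH h₀ + ν • h₀) :
    let W := H ⊗[ℂ] V
    let bigH : W →ₗ[ℂ] W :=
      TensorProduct.map πH LinearMap.id + (ν + ((Real.sqrt 2 : ℂ))⁻¹) • LinearMap.id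
    let bigE : W →ₗ[ℂ] W := TensorProduct.map πE LinearMap.id
    let d0 : W →ₗ[ℂ] W × W := bigH.prod bigE
    let d1 : W × W →ₗ[ℂ] W :=
      bigH ∘ₗ LinearMap.snd ℂ W W - bigE ∘ₗ LinearMap.fst ℂ W W -
        ((Real.sqrt 2 : ℂ))⁻¹ • LinearMap.snd ℂ W W
    let δ1 : W × W →ₗ[ℂ] W := TensorProduct.map T LinearMap.id ∘ₗ LinearMap.snd ℂ W W
    let δ2 : W →ₗ[ℂ] W × W :=
      (-(TensorProduct.map T (LinearMap.id : V →ₗ[ℂ] V))).prod (0 : W →ₗ[ℂ] W)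
    let Φ : W →ₗ[ℂ] W :=
      TensorProduct.map (LinearMap.toSpanSingleton ℂ H h₀ ∘ₗ φ) LinearMap.id
    let Φ' : W →ₗ[ℂ] W :=
      TensorProduct.map (LinearMap.toSpanSingleton ℂ H h₀' ∘ₗ φ) LinearMap.id
    let p1 : W × W →ₗ[ℂ] W × W :=
      (Φ' ∘ₗ LinearMap.snd ℂ W W).prod (Φ ∘ₗ LinearMap.snd ℂ W W)
    let p2 : W →ₗ[ℂ] W := Φ
    -- p is idempotent
    p1 ∘ₗ p1 = p1 ∧ p2 ∘ₗ p2 = p2 ∧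
    -- d∘p = 0 and p∘d = 0
    d1 ∘ₗ p1 = 0 ∧ p1 ∘ₗ d0 = 0 ∧ p2 ∘ₗ d1 = 0 ∧
    -- δ∘p = 0 and p∘δ = 0
    δ1 ∘ₗ p1 = 0 ∧ δ2 ∘ₗ p2 = 0 ∧ p1 ∘ₗ δ2 = 0 ∧
    -- dδ + δd = id − p in each degree
    δ1 ∘ₗ d0 = LinearMap.id ∧
    d0 ∘ₗ δ1 + δ2 ∘ₗ d1 = LinearMap.id - p1 ∧
    d1 ∘ₗ δ2 = LinearMap.id - p2 ∧
    -- pointwise Hodge decompositions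
    (∀ w : W, w = δ1 (d0 w)) ∧
    (∀ x : W × W, x = p1 x + d0 (δ1 x) + δ2 (d1 x)) ∧
    (∀ w : W, w = p2 w + d1 (δ2 w)) ∧
    -- degree 0
    LinearMap.ker d0 = ⊥ ∧
    LinearMap.range δ1 = ⊤ ∧
    -- degree 1: range p¹ ⊕ range d⁰ ⊕ range δ² with the stated identifications
    Disjoint (LinearMap.range d0) (LinearMap.range δ2) ∧
    Disjoint (LinearMap.range p1) (LinearMap.range d0 ⊔ LinearMap.range δ2) ∧
    LinearMap.range p1 ⊔ LinearMap.range d0 ⊔ LinearMap.range δ2 = ⊤ ∧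
    LinearMap.range p1 = LinearMap.ker d1 ⊓ LinearMap.ker δ1 ∧
    LinearMap.ker p1 = LinearMap.range d0 ⊔ LinearMap.range δ2 ∧
    LinearMap.ker d1 = LinearMap.range p1 ⊔ LinearMap.range d0 ∧
    LinearMap.ker δ1 = LinearMap.range p1 ⊔ LinearMap.range δ2 ∧
    -- degree 2: range p² ⊕ range d¹
    Disjoint (LinearMap.range p2) (LinearMap.range d1) ∧
    LinearMap.range p2 ⊔ LinearMap.range d1 = ⊤ ∧
    LinearMap.range p2 = LinearMap.ker δ2 ∧
    LinearMap.ker p2 = LinearMap.range d1 ∧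
    -- the cohomology is isomorphic, degree by degree, to the range of p
    Nonempty ((↥(LinearMap.ker d1) ⧸
        (LinearMap.range d0).comap (LinearMap.ker d1).subtype) ≃ₗ[ℂ]
      ↥(LinearMap.range p1)) ∧
    Nonempty ((W ⧸ LinearMap.range d1) ≃ₗ[ℂ] ↥(LinearMap.range p2)) := by
  set s : ℂ := ((Real.sqrt 2 : ℂ))⁻¹
  have hφE (x : H) : φ (πE x) = 0 := by
    rw [← LinearMap.mem_ker, hker]; exact ⟨x, rfl⟩
  have hφH' (x : H) : φ (πH x) = -ν * φ x := LinearMap.congr_fun hφH x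
  have hET (x : H) : πE (T x) = x - φ x • h₀ := LinearMap.congr_fun hT x
  have hHE (x : H) : πH (πE x) = πE (πH x) + s • πE x := by
    have := LinearMap.congr_fun hcomm x
    simp only [LinearMap.sub_apply, LinearMap.comp_apply, LinearMap.smul_apply] at this
    rw [← this]; abel
  have hTh₀ : T h₀ = 0 := hinj (by rw [hET, hh₀]; simp)
  have hTE (x : H) : T (πE x) = x := hinj (by rw [hET, hφE]; simp)
  have hHT (x : H) : πH (T x) = T (πH x) - s • T x - φ x • h₀' := by
    apply hinj
    have h := hHE (T x)
    rw [hET, map_sub, map_smul] at h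
    rw [map_sub, map_sub, map_smul, map_smul, hET, hET, hφH', hh₀', ← sub_eq_iff_eq_add.2 h]
    module
  let bigH : H ⊗[ℂ] V →ₗ[ℂ] H ⊗[ℂ] V :=
    TensorProduct.map πH LinearMap.id + (ν + s) • LinearMap.id
  let bigE : H ⊗[ℂ] V →ₗ[ℂ] H ⊗[ℂ] V := TensorProduct.map πE LinearMap.id
  let t : H ⊗[ℂ] V →ₗ[ℂ] H ⊗[ℂ] V := TensorProduct.map T LinearMap.id
  let Φ : H ⊗[ℂ] V →ₗ[ℂ] H ⊗[ℂ] V :=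
    TensorProduct.map (LinearMap.toSpanSingleton ℂ H h₀ ∘ₗ φ) LinearMap.id
  let Φ' : H ⊗[ℂ] V →ₗ[ℂ] H ⊗[ℂ] V :=
    TensorProduct.map (LinearMap.toSpanSingleton ℂ H h₀' ∘ₗ φ) LinearMap.id
  have eHE (w : H ⊗[ℂ] V) : bigH (bigE w) = bigE (bigH w) + s • bigE w := by
    induction w using TensorProduct.induction_on with
    | zero => simp
    | tmul x v =>
      simp only [bigH, bigE, LinearMap.add_apply, LinearMap.smul_apply, TensorProduct.map_tmul,
        LinearMap.id_apply, hHE, map_add, map_smul, TensorProduct.add_tmul,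
        ← TensorProduct.smul_tmul']
      module
    | add x y hx hy => simp only [map_add, hx, hy, smul_add]; abel
  have eET (w : H ⊗[ℂ] V) : bigE (t w) = w - Φ w := by
    induction w using TensorProduct.induction_on with
    | zero => simp
    | tmul x v => simp [bigE, t, Φ, hET, TensorProduct.sub_tmul]
    | add x y hx hy => simp only [map_add, hx, hy]; abel
  have eTE (w : H ⊗[ℂ] V) : t (bigE w) = w := by
    induction w using TensorProduct.induction_on with
    | zero => simp
    | tmul x v => simp [bigE, t, hTE]
    | add x y hx hy => simp only [map_add, hx, hy]
  have eTΦ (w : H ⊗[ℂ] V) : t (Φ w) = 0 := by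
    induction w using TensorProduct.induction_on with
    | zero => simp
    | tmul x v => simp [t, Φ, hTh₀]
    | add x y hx hy => simp only [map_add, hx, hy, add_zero]
  have eΦE (w : H ⊗[ℂ] V) : Φ (bigE w) = 0 := by
    induction w using TensorProduct.induction_on with
    | zero => simp
    | tmul x v => simp [bigE, Φ, hφE]
    | add x y hx hy => simp only [map_add, hx, hy, add_zero]
  have eΦ'E (w : H ⊗[ℂ] V) : Φ' (bigE w) = 0 := by
    induction w using TensorProduct.induction_on with
    | zero => simp
    | tmul x v => simp [bigE, Φ', hφE]
    | add x y hx hy => simp only [map_add, hx, hy, add_zero]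
  have eΦΦ (w : H ⊗[ℂ] V) : Φ (Φ w) = Φ w := by
    induction w using TensorProduct.induction_on with
    | zero => simp
    | tmul x v => simp [Φ, hh₀]
    | add x y hx hy => simp only [map_add, hx, hy]
  have eΦ'Φ (w : H ⊗[ℂ] V) : Φ' (Φ w) = Φ' w := by
    induction w using TensorProduct.induction_on with
    | zero => simp
    | tmul x v => simp [Φ, Φ', hh₀]
    | add x y hx hy => simp only [map_add, hx, hy]
  have eHΦ (w : H ⊗[ℂ] V) : bigH (Φ w) = bigE (Φ' w) + s • Φ w := by
    induction w using TensorProduct.induction_on with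
    | zero => simp
    | tmul x v =>
      simp only [bigH, bigE, Φ, Φ', LinearMap.add_apply, LinearMap.smul_apply,
        TensorProduct.map_tmul, LinearMap.id_apply, LinearMap.comp_apply,
        LinearMap.toSpanSingleton_apply, map_smul, hh₀', TensorProduct.add_tmul,
        ← TensorProduct.smul_tmul']
      module
    | add x y hx hy => simp only [map_add, hx, hy, smul_add]; abel
  have eΦH (w : H ⊗[ℂ] V) : Φ (bigH w) = s • Φ w := by
    induction w using TensorProduct.induction_on with
    | zero => simp
    | tmul x v =>
      simp only [bigH, Φ, LinearMap.add_apply, LinearMap.smul_apply,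
        TensorProduct.map_tmul, LinearMap.id_apply, LinearMap.comp_apply,
        LinearMap.toSpanSingleton_apply, map_smul, map_add, hφH',
        ← TensorProduct.smul_tmul']
      module
    | add x y hx hy => simp only [map_add, hx, hy, smul_add]
  have eHT (w : H ⊗[ℂ] V) : bigH (t w) = t (bigH w) - s • t w - Φ' w := by
    induction w using TensorProduct.induction_on with
    | zero => simp
    | tmul x v =>
      simp only [bigH, t, Φ', LinearMap.add_apply, LinearMap.smul_apply,
        TensorProduct.map_tmul, LinearMap.id_apply, LinearMap.comp_apply,
        LinearMap.toSpanSingleton_apply, map_smul, map_add, hHT, TensorProduct.sub_tmul,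
        ← TensorProduct.smul_tmul']
      module
    | add x y hx hy => simp only [map_add, hx, hy, smul_add]; abel
  let d0 := bigH.prod bigE
  let d1 := bigH ∘ₗ LinearMap.snd ℂ _ _ - bigE ∘ₗ LinearMap.fst ℂ _ _ - s • LinearMap.snd ℂ _ _
  let δ1 := t ∘ₗ LinearMap.snd ℂ (H ⊗[ℂ] V) _
  let δ2 := (-t).prod (0 : H ⊗[ℂ] V →ₗ[ℂ] H ⊗[ℂ] V)
  let p1 := (Φ' ∘ₗ LinearMap.snd ℂ (H ⊗[ℂ] V) _).prod (Φ ∘ₗ LinearMap.snd ℂ _ _)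
  have d0_apply (w : H ⊗[ℂ] V) : d0 w = (bigH w, bigE w) := rfl
  have d1_apply (x : (H ⊗[ℂ] V) × (H ⊗[ℂ] V)) : d1 x = bigH x.2 - bigE x.1 - s • x.2 := rfl
  have δ1_apply (x : (H ⊗[ℂ] V) × (H ⊗[ℂ] V)) : δ1 x = t x.2 := rfl
  have δ2_apply (w : H ⊗[ℂ] V) : δ2 w = (-t w, 0) := rfl
  have p1_apply (x : (H ⊗[ℂ] V) × (H ⊗[ℂ] V)) : p1 x = (Φ' x.2, Φ x.2) := rfl
  have δd (w : H ⊗[ℂ] V) : δ1 (d0 w) = w := eTE w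
  have h1 : HodgeSplitting d0 d1 δ1 δ2 p1 :=
    { d_d := fun w => by simp only [d0_apply, d1_apply, eHE]; abel
      δ_δ := fun w => by simp only [δ1_apply, δ2_apply, map_zero]
      p_p := fun x => by simp only [p1_apply, eΦΦ, eΦ'Φ]
      d_p := fun x => by simp only [d1_apply, p1_apply, eHΦ]; abel
      p_d := fun w => by simp only [d0_apply, p1_apply, eΦE, eΦ'E, Prod.mk_zero_zero]
      δ_p := fun x => by simp only [δ1_apply, p1_apply, eTΦ]
      p_δ := fun w => by simp only [δ2_apply, p1_apply, map_zero, Prod.mk_zero_zero]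
      homotopy := fun x => by
        ext1
        · simp only [d0_apply, d1_apply, δ1_apply, δ2_apply, p1_apply, Prod.fst_add,
            Prod.fst_sub, eHT, map_sub, map_smul, eTE]
          abel
        · simp only [d0_apply, δ1_apply, δ2_apply, p1_apply, Prod.snd_add, Prod.snd_sub, eET,
            add_zero] }
  have h2 : HodgeSplitting d1 (0 : H ⊗[ℂ] V →ₗ[ℂ] H ⊗[ℂ] V) δ2 (0 : H ⊗[ℂ] V →ₗ[ℂ] H ⊗[ℂ] V) Φ :=
    { d_d := fun _ => rfl
      δ_δ := fun _ => map_zero _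
      p_p := eΦΦ
      d_p := fun _ => rfl
      p_d := fun x => by simp only [d1_apply, map_sub, map_smul, eΦH, eΦE]; abel
      δ_p := fun w => by simp only [δ2_apply, eTΦ, neg_zero, Prod.mk_zero_zero]
      p_δ := fun _ => map_zero _
      homotopy := fun w => by
        simp only [δ2_apply, d1_apply, map_neg, map_zero, smul_zero, eET,
          LinearMap.zero_apply]
        abel }
  have hkerΦ : LinearMap.ker Φ = LinearMap.range d1 := by simpa using h2.ker_p
  have hdδ : ∀ w, d1 (δ2 w) = w - Φ w := fun w => by simpa using h2.homotopy w
  have hdecomp : ∀ w, w = Φ w + d1 (δ2 w) := fun w => by simpa using h2.decomp w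
  have hdisj : Disjoint (LinearMap.range Φ) (LinearMap.range d1) := by simpa using h2.disjoint_p
  have hsup : LinearMap.range Φ ⊔ LinearMap.range d1 = ⊤ := by simpa using h2.sup_eq_top
  have hrange : LinearMap.range Φ = LinearMap.ker δ2 := by simpa using h2.range_p
  intro _ _ _ _ _ _ _ _ _ _ _
  exact ⟨LinearMap.ext h1.p_p, LinearMap.ext h2.p_p, LinearMap.ext h1.d_p, LinearMap.ext h1.p_d,
    LinearMap.ext h2.p_d, LinearMap.ext h1.δ_p, LinearMap.ext h2.δ_p, LinearMap.ext h1.p_δ,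
    LinearMap.ext δd, LinearMap.ext h1.homotopy,
    LinearMap.ext hdδ,
    fun w => (δd w).symm, h1.decomp, hdecomp,
    LinearMap.ker_eq_bot.2 (Function.LeftInverse.injective δd),
    LinearMap.range_eq_top.2 (Function.RightInverse.surjective δd),
    h1.disjoint_d_δ, h1.disjoint_p, h1.sup_eq_top, h1.range_p, h1.ker_p, h1.ker_d, h1.ker_δ,
    hdisj, hsup, hrange, hkerΦ, h1.nonempty_cohomology_equiv,
    ⟨(Submodule.quotEquivOfEq _ _ hkerΦ.symm).trans Φ.quotKerEquivRange⟩⟩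
end
end

section
/- Let d₀ : ℂ² → ℂ⁴ and d₁ : ℂ⁴ → ℂ² be the linear maps with matrices d₀ = [[0,0],[0,1/√2],[0,0],[-1/√2,0]] and d₁ = [[0,0,-1/√2,0],[1/√2,0,0,0]]. Then linear maps δ₁ : ℂ⁴ → ℂ² and δ₂ : ℂ² → ℂ⁴ satisfy δ₁∘d₀ = id on ℂ², d₀∘δ₁ + δ₂∘d₁ = id on ℂ⁴, and d₁∘δ₂ = id on ℂ² if and only if there exist a, b, c, e ∈ ℂ such that δ₁ has matrix [[a,0,b,-√2],[c,√2,e,0]] and δ₂ has matrix [[0,√2],[e,-c],[-√2,0],[-b,a]]. Moreover any such pair satisfies δ₁∘δ₂ = 0. In particular the complex 0 → ℂ² → ℂ⁴ → ℂ² → 0 with differentials d₀, d₁ is exact. -/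
noncomputable section

/-- The contracting homotopies of the complex with differentials `d₀`, `d₁`, for an arbitrary
nonzero scalar `t` in place of `√2`. -/
theorem matrix_contraction_iff {K : Type*} [Field K] {t : K} (ht : t ≠ 0)
    (P : Matrix (Fin 2) (Fin 4) K) (Q : Matrix (Fin 4) (Fin 2) K) :
    (P * !![0, 0; 0, t⁻¹; 0, 0; -t⁻¹, 0] = 1 ∧
      !![0, 0; 0, t⁻¹; 0, 0; -t⁻¹, 0] * P + Q * !![0, 0, -t⁻¹, 0; t⁻¹, 0, 0, 0] = 1 ∧
      !![0, 0, -t⁻¹, 0; t⁻¹, 0, 0, 0] * Q = 1) ↔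
    ∃ a b c e : K, P = !![a, 0, b, -t; c, t, e, 0] ∧ Q = !![0, t; e, -c; -t, 0; -b, a] := by
  constructor
  · rintro ⟨h₁, h₂, h₃⟩
    rw [← Matrix.ext_iff] at h₁ h₂ h₃
    simp only [Fin.forall_fin_succ, Matrix.add_apply, Matrix.mul_apply,
      Fin.sum_univ_two, Fin.sum_univ_four, Matrix.one_apply] at h₁ h₂ h₃
    simp at h₁ h₂ h₃
    refine ⟨P 0 0, P 0 2, P 1 0, P 1 2, ?_, ?_⟩ <;> ext i j <;> fin_cases i <;> fin_cases j <;>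
      simp <;> grind
  · rintro ⟨a, b, c, e, rfl, rfl⟩
    refine ⟨?_, ?_, ?_⟩ <;> ext i j <;> fin_cases i <;> fin_cases j <;>
      simp [Matrix.mul_apply, Fin.sum_univ_four, ht] <;> ring

/-- A contracting homotopy makes a two-step complex exact. -/
theorem exact_of_contraction {R A B C : Type*} [Ring R] [AddCommGroup A] [AddCommGroup B]
    [AddCommGroup C] [Module R A] [Module R B] [Module R C]
    {d₀ : A →ₗ[R] B} {d₁ : B →ₗ[R] C} {δ₁ : B →ₗ[R] A} {δ₂ : C →ₗ[R] B}
    (hd : d₁ ∘ₗ d₀ = 0) (h₁ : δ₁ ∘ₗ d₀ = LinearMap.id)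
    (h₂ : d₀ ∘ₗ δ₁ + δ₂ ∘ₗ d₁ = LinearMap.id) (h₃ : d₁ ∘ₗ δ₂ = LinearMap.id) :
    LinearMap.ker d₀ = ⊥ ∧ LinearMap.ker d₁ = LinearMap.range d₀ ∧ LinearMap.range d₁ = ⊤ := by
  refine ⟨LinearMap.ker_eq_bot_of_inverse h₁, le_antisymm (fun x hx => ⟨δ₁ x, ?_⟩)
    (LinearMap.range_le_ker_iff.mpr hd), LinearMap.range_eq_top.mpr fun y =>
      ⟨δ₂ y, LinearMap.congr_fun h₃ y⟩⟩
  have h := LinearMap.congr_fun h₂ x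
  simpa [LinearMap.mem_ker.mp hx] using h

/-- Let `d₀ : ℂ² → ℂ⁴` and `d₁ : ℂ⁴ → ℂ²` be the linear maps with matrices
`[[0,0],[0,1/√2],[0,0],[-1/√2,0]]` and `[[0,0,-1/√2,0],[1/√2,0,0,0]]`.  Then `δ₁ : ℂ⁴ → ℂ²`
and `δ₂ : ℂ² → ℂ⁴` satisfy `δ₁∘d₀ = id`, `d₀∘δ₁ + δ₂∘d₁ = id` and `d₁∘δ₂ = id` if and only
if there are `a, b, c, e ∈ ℂ` with `δ₁ = [[a,0,b,-√2],[c,√2,e,0]]` and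
`δ₂ = [[0,√2],[e,-c],[-√2,0],[-b,a]]`; moreover any such pair satisfies `δ₁∘δ₂ = 0`.
In particular the complex `0 → ℂ² → ℂ⁴ → ℂ² → 0` is exact. -/
theorem stmt19 :
    let d0 : (Fin 2 → ℂ) →ₗ[ℂ] (Fin 4 → ℂ) :=
      Matrix.toLin' !![0, 0; 0, ((Real.sqrt 2 : ℂ))⁻¹; 0, 0; -((Real.sqrt 2 : ℂ))⁻¹, 0]
    let d1 : (Fin 4 → ℂ) →ₗ[ℂ] (Fin 2 → ℂ) :=
      Matrix.toLin' !![0, 0, -((Real.sqrt 2 : ℂ))⁻¹, 0; ((Real.sqrt 2 : ℂ))⁻¹, 0, 0, 0]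
    (∀ (δ1 : (Fin 4 → ℂ) →ₗ[ℂ] (Fin 2 → ℂ)) (δ2 : (Fin 2 → ℂ) →ₗ[ℂ] (Fin 4 → ℂ)),
      (δ1 ∘ₗ d0 = LinearMap.id ∧ d0 ∘ₗ δ1 + δ2 ∘ₗ d1 = LinearMap.id ∧
        d1 ∘ₗ δ2 = LinearMap.id) ↔
      (∃ a b c e : ℂ,
        δ1 = Matrix.toLin'
          !![a, 0, b, -(Real.sqrt 2 : ℂ); c, (Real.sqrt 2 : ℂ), e, 0] ∧
        δ2 = Matrix.toLin'
          !![0, (Real.sqrt 2 : ℂ); e, -c; -(Real.sqrt 2 : ℂ), 0; -b, a])) ∧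
    (∀ (δ1 : (Fin 4 → ℂ) →ₗ[ℂ] (Fin 2 → ℂ)) (δ2 : (Fin 2 → ℂ) →ₗ[ℂ] (Fin 4 → ℂ)),
      (δ1 ∘ₗ d0 = LinearMap.id ∧ d0 ∘ₗ δ1 + δ2 ∘ₗ d1 = LinearMap.id ∧
        d1 ∘ₗ δ2 = LinearMap.id) → δ1 ∘ₗ δ2 = 0) ∧
    LinearMap.ker d0 = ⊥ ∧
    LinearMap.ker d1 = LinearMap.range d0 ∧
    LinearMap.range d1 = ⊤ := by
  intro d0 d1
  have ht : (Real.sqrt 2 : ℂ) ≠ 0 := by simp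
  have key : ∀ (δ1 : (Fin 4 → ℂ) →ₗ[ℂ] (Fin 2 → ℂ)) (δ2 : (Fin 2 → ℂ) →ₗ[ℂ] (Fin 4 → ℂ)),
      (δ1 ∘ₗ d0 = LinearMap.id ∧ d0 ∘ₗ δ1 + δ2 ∘ₗ d1 = LinearMap.id ∧
        d1 ∘ₗ δ2 = LinearMap.id) ↔
      (∃ a b c e : ℂ,
        δ1 = Matrix.toLin'
          !![a, 0, b, -(Real.sqrt 2 : ℂ); c, (Real.sqrt 2 : ℂ), e, 0] ∧
        δ2 = Matrix.toLin'
          !![0, (Real.sqrt 2 : ℂ); e, -c; -(Real.sqrt 2 : ℂ), 0; -b, a]) := by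
    intro δ1 δ2
    obtain ⟨P, rfl⟩ := Matrix.toLin'.surjective δ1
    obtain ⟨Q, rfl⟩ := Matrix.toLin'.surjective δ2
    simp only [d0, d1, ← Matrix.toLin'_mul, ← map_add, ← Matrix.toLin'_one,
      Matrix.toLin'.injective.eq_iff]
    exact matrix_contraction_iff ht P Q
  have hd : d1 ∘ₗ d0 = 0 := by
    rw [← Matrix.toLin'_mul, ← map_zero Matrix.toLin']
    congr 1
    ext i j
    fin_cases i <;> fin_cases j <;> simp [Matrix.mul_apply, Fin.sum_univ_four]
  refine ⟨key, fun δ1 δ2 h => ?_, ?_⟩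
  · obtain ⟨a, b, c, e, rfl, rfl⟩ := (key δ1 δ2).mp h
    rw [← Matrix.toLin'_mul, ← map_zero Matrix.toLin']
    congr 1
    ext i j
    fin_cases i <;> fin_cases j <;> simp [Matrix.mul_apply, Fin.sum_univ_four] <;> ring
  · obtain ⟨h₁, h₂, h₃⟩ := (key _ _).mpr ⟨0, 0, 0, 0, rfl, rfl⟩
    exact exact_of_contraction hd h₁ h₂ h₃
end
end
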